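/- Let G ≤ S_n be a permutation group and let Δ₁, Δ₂ be polytopes. The permutation polytope P(G) is combinatorially equivalent to the product Δ₁ × Δ₂ if and only if there exist subgroups H₁, H₂ ≤ G such that: (a) P(Hᵢ) is combinatorially equivalent to Δᵢ for i = 1,2; (b) the supports of H₁ and H₂ are disjoint, i.e., no point of {1,…,n} is moved both by some element of H₁ and by some element of H₂; and (c) G = H₁H₂ with H₁ ∩ H₂ = {e} and every element of H₁ commuting with every element of H₂ (so G is the internal direct product H₁ × H₂). -/

import Mathlib

/-- The permutation matrix of `σ ∈ S_n`: entry `(i, j)` is `1` iff `σ j = i`. -/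
def permMat {n : ℕ} (σ : Equiv.Perm (Fin n)) : Matrix (Fin n) (Fin n) ℝ :=
  Matrix.of fun i j => if σ j = i then 1 else 0

/-- The permutation polytope of a permutation group `G ≤ S_n`. -/
def permPoly {n : ℕ} (G : Subgroup (Equiv.Perm (Fin n))) :
    Set (Matrix (Fin n) (Fin n) ℝ) :=
  convexHull ℝ {M | ∃ g ∈ G, M = permMat g}

/-- Two polytopes are combinatorially equivalent if there is an order isomorphism
between their posets of (exposed) faces, ordered by inclusion. -/
def CombEquiv {E F : Type*} [AddCommGroup E] [Module ℝ E] [TopologicalSpace E]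
    [AddCommGroup F] [Module ℝ F] [TopologicalSpace F] (P : Set E) (Q : Set F) : Prop :=
  Nonempty ({A : Set E // IsExposed ℝ P A} ≃o {B : Set F // IsExposed ℝ Q B})

section Faces

variable {E F : Type*} [AddCommGroup E] [Module ℝ E] [TopologicalSpace E]
  [AddCommGroup F] [Module ℝ F] [TopologicalSpace F]

/-- The nonempty exposed faces of `P`, ordered by inclusion. -/
abbrev NonemptyFace (P : Set E) : Type _ := {A : Set E // IsExposed ℝ P A ∧ A.Nonempty}

/-- The improper face of a nonempty set. -/
def NonemptyFace.whole {P : Set E} (hP : P.Nonempty) : NonemptyFace P :=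
  ⟨P, IsExposed.refl P, hP⟩

theorem NonemptyFace.le_whole {P : Set E} (hP : P.Nonempty) (A : NonemptyFace P) :
    A ≤ NonemptyFace.whole hP :=
  A.2.1.subset

theorem CombEquiv.nonempty_face_orderIso {P : Set E} {Q : Set F} (h : CombEquiv P Q) :
    Nonempty (NonemptyFace P ≃o NonemptyFace Q) := by
  obtain ⟨e⟩ := h
  have hbot : e ⟨∅, isExposed_empty⟩ = ⟨∅, isExposed_empty⟩ := by
    apply le_antisymm
    · rw [← e.le_symm_apply]
      exact Set.empty_subset _
    · exact Set.empty_subset _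
  have hne : ∀ A, (e A).1.Nonempty ↔ A.1.Nonempty := by
    intro A
    simp only [Set.nonempty_iff_ne_empty, ne_eq, not_iff_not]
    constructor
    · intro h0
      have : e A = e ⟨∅, isExposed_empty⟩ := by rw [hbot]; exact Subtype.ext h0
      exact congrArg Subtype.val (e.injective this)
    · intro h0
      have : A = ⟨∅, isExposed_empty⟩ := Subtype.ext h0
      rw [this, hbot]
  refine ⟨OrderIso.ofSurjective (OrderEmbedding.ofMapLEIff
    (fun A => ⟨(e ⟨A.1, A.2.1⟩).1, (e ⟨A.1, A.2.1⟩).2, (hne _).2 A.2.2⟩) ?_) ?_⟩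
  · intro A B
    exact e.le_iff_le (x := ⟨A.1, A.2.1⟩) (y := ⟨B.1, B.2.1⟩)
  · intro B
    have h1 : (e (e.symm ⟨B.1, B.2.1⟩)).1.Nonempty := by simpa using B.2.2
    refine ⟨⟨(e.symm ⟨B.1, B.2.1⟩).1, (e.symm ⟨B.1, B.2.1⟩).2, (hne _).1 h1⟩, ?_⟩
    apply Subtype.ext
    change (e (e.symm ⟨B.1, B.2.1⟩)).1 = B.1
    simp

open Classical in
theorem combEquiv_of_orderIso {P : Set E} {Q : Set F} (e : NonemptyFace P ≃o NonemptyFace Q) :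
    CombEquiv P Q := by
  let f : {A : Set E // IsExposed ℝ P A} → {B : Set F // IsExposed ℝ Q B} := fun A =>
    if h : A.1.Nonempty then ⟨(e ⟨A.1, A.2, h⟩).1, (e ⟨A.1, A.2, h⟩).2.1⟩
    else ⟨∅, isExposed_empty⟩
  have hf : ∀ A (h : A.1.Nonempty), (f A).1 = (e ⟨A.1, A.2, h⟩).1 := fun A h => by
    simp only [f, dif_pos h]
  have hf' : ∀ A, ¬ A.1.Nonempty → (f A).1 = ∅ := fun A h => by
    simp only [f, dif_neg h]
  refine ⟨OrderIso.ofSurjective (OrderEmbedding.ofMapLEIff f ?_) ?_⟩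
  · intro A B
    change (f A).1 ⊆ (f B).1 ↔ A.1 ⊆ B.1
    by_cases hA : A.1.Nonempty
    · by_cases hB : B.1.Nonempty
      · rw [hf A hA, hf B hB]
        exact e.le_iff_le (x := ⟨A.1, A.2, hA⟩) (y := ⟨B.1, B.2, hB⟩)
      · rw [hf A hA, hf' B hB]
        constructor
        · intro h
          exact absurd ((e ⟨A.1, A.2, hA⟩).2.2.mono h) Set.not_nonempty_empty
        · intro h
          exact absurd (hA.mono h) hB
    · rw [hf' A hA, Set.not_nonempty_iff_eq_empty.1 hA]
      simp
  · intro B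
    by_cases hB : B.1.Nonempty
    · refine ⟨⟨(e.symm ⟨B.1, B.2, hB⟩).1, (e.symm ⟨B.1, B.2, hB⟩).2.1⟩, Subtype.ext ?_⟩
      refine (hf _ (e.symm ⟨B.1, B.2, hB⟩).2.2).trans ?_
      exact congrArg Subtype.val (e.apply_symm_apply ⟨B.1, B.2, hB⟩)
    · refine ⟨⟨∅, isExposed_empty⟩, Subtype.ext ?_⟩
      refine (hf' _ Set.not_nonempty_empty).trans ?_
      exact (Set.not_nonempty_iff_eq_empty.1 hB).symm

theorem IsExposed.prod {P A : Set E} {Q B : Set F} (hA : IsExposed ℝ P A)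
    (hB : IsExposed ℝ Q B) : IsExposed ℝ (P ×ˢ Q) (A ×ˢ B) := by
  rintro ⟨⟨x₀, y₀⟩, hx₀, hy₀⟩
  obtain ⟨l, rfl⟩ := hA ⟨x₀, hx₀⟩
  obtain ⟨m, rfl⟩ := hB ⟨y₀, hy₀⟩
  refine ⟨l.coprod m, ?_⟩
  ext ⟨x, y⟩
  simp only [Set.mem_prod, Set.mem_ofPred_eq, ContinuousLinearMap.coprod_apply, Prod.forall]
  constructor
  · rintro ⟨⟨hx, hlx⟩, hy, hmy⟩
    exact ⟨⟨hx, hy⟩, fun a b hab => add_le_add (hlx a hab.1) (hmy b hab.2)⟩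
  · rintro ⟨⟨hx, hy⟩, h⟩
    exact ⟨⟨hx, fun a ha => by simpa using h a y ⟨ha, hy⟩⟩,
      hy, fun b hb => by simpa using h x b ⟨hx, hb⟩⟩

theorem IsExposed.exists_eq_prod {P : Set E} {Q : Set F} {C : Set (E × F)}
    (hC : IsExposed ℝ (P ×ˢ Q) C) (hne : C.Nonempty) :
    ∃ A B, IsExposed ℝ P A ∧ IsExposed ℝ Q B ∧ C = A ×ˢ B := by
  obtain ⟨l, rfl⟩ := hC hne
  refine ⟨(l.comp (ContinuousLinearMap.inl ℝ E F)).toExposed P,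
    (l.comp (ContinuousLinearMap.inr ℝ E F)).toExposed Q,
    ContinuousLinearMap.toExposed.isExposed, ContinuousLinearMap.toExposed.isExposed, ?_⟩
  have hl : ∀ x y, l (x, y) = l (x, 0) + l (0, y) := fun x y => by rw [← map_add]; simp
  ext ⟨x, y⟩
  simp only [ContinuousLinearMap.toExposed, Set.mem_prod, Set.mem_ofPred_eq, Prod.forall,
    ContinuousLinearMap.comp_apply, ContinuousLinearMap.inl_apply, ContinuousLinearMap.inr_apply]
  constructor
  · rintro ⟨⟨hx, hy⟩, h⟩
    refine ⟨⟨hx, fun a ha => ?_⟩, hy, fun b hb => ?_⟩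
    · have := h a y ⟨ha, hy⟩
      rw [hl a, hl x] at this
      linarith
    · have := h x b ⟨hx, hb⟩
      rw [hl x b, hl x y] at this
      linarith
  · rintro ⟨⟨hx, hlx⟩, hy, hmy⟩
    refine ⟨⟨hx, hy⟩, fun a b hab => ?_⟩
    rw [hl a, hl x]
    exact add_le_add (hlx a hab.1) (hmy b hab.2)

/-- The nonempty faces of a product are the products of nonempty faces. -/
noncomputable def NonemptyFace.prodOrderIso (P : Set E) (Q : Set F) :
    NonemptyFace P × NonemptyFace Q ≃o NonemptyFace (P ×ˢ Q) :=
  OrderIso.ofSurjective (OrderEmbedding.ofMapLEIff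
    (fun A => ⟨A.1.1 ×ˢ A.2.1, A.1.2.1.prod A.2.2.1, A.1.2.2.prod A.2.2.2⟩) (by
      rintro ⟨A, B⟩ ⟨A', B'⟩
      change A.1 ×ˢ B.1 ⊆ A'.1 ×ˢ B'.1 ↔ A.1 ⊆ A'.1 ∧ B.1 ⊆ B'.1
      rw [Set.prod_subset_prod_iff]
      have h1 := A.2.2.ne_empty
      have h2 := B.2.2.ne_empty
      tauto)) (by
    rintro ⟨C, hC, hne⟩
    obtain ⟨A, B, hA, hB, rfl⟩ := hC.exists_eq_prod hne
    exact ⟨(⟨A, hA, hne.fst⟩, ⟨B, hB, hne.snd⟩), rfl⟩)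

/-- The product of two isomorphisms between posets of nonempty faces. -/
def NonemptyFace.prodCongr {E' F' : Type*} [AddCommGroup E'] [Module ℝ E'] [TopologicalSpace E']
    [AddCommGroup F'] [Module ℝ F'] [TopologicalSpace F'] {P : Set E} {Q : Set F} {P' : Set E'}
    {Q' : Set F'} (e : NonemptyFace P ≃o NonemptyFace P') (f : NonemptyFace Q ≃o NonemptyFace Q') :
    NonemptyFace P × NonemptyFace Q ≃o NonemptyFace P' × NonemptyFace Q' where
  toEquiv := e.toEquiv.prodCongr f.toEquiv
  map_rel_iff' {_ _} := and_congr e.le_iff_le f.le_iff_le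

/-- Exposed faces pull back along affine maps. -/
theorem IsExposed.affine_preimage {P : Set E} {Q B : Set F} (hB : IsExposed ℝ Q B)
    (L : E →L[ℝ] F) (c : F) (h : ∀ x ∈ P, L x + c ∈ Q) :
    IsExposed ℝ P {x ∈ P | L x + c ∈ B} := by
  rintro ⟨x₀, hx₀, hx₀B⟩
  obtain ⟨l, rfl⟩ := hB ⟨_, hx₀B⟩
  refine ⟨l.comp L, ?_⟩
  ext x
  simp only [Set.mem_ofPred_eq, ContinuousLinearMap.comp_apply]
  constructor
  · rintro ⟨hx, -, h'⟩
    refine ⟨hx, fun y hy => ?_⟩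
    simpa using h' _ (h y hy)
  · rintro ⟨hx, h'⟩
    refine ⟨hx, h x hx, fun y hy => ?_⟩
    have h1 := hx₀B.2 y hy
    have h2 := h' x₀ hx₀
    rw [map_add] at h1 ⊢
    linarith

/-- Affinely isomorphic sets have isomorphic posets of nonempty faces. -/
def NonemptyFace.affineOrderIso {P : Set E} {Q : Set F} (L : E →L[ℝ] F) (c : F)
    (L' : F →L[ℝ] E) (c' : E) (h : ∀ x ∈ P, L x + c ∈ Q) (h' : ∀ y ∈ Q, L' y + c' ∈ P)
    (hl : ∀ x ∈ P, L' (L x + c) + c' = x) (hr : ∀ y ∈ Q, L (L' y + c') + c = y) :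
    NonemptyFace P ≃o NonemptyFace Q where
  toFun A := ⟨{y ∈ Q | L' y + c' ∈ A.1}, A.2.1.affine_preimage L' c' h', by
    obtain ⟨x, hx⟩ := A.2.2
    have hxP := A.2.1.subset hx
    exact ⟨L x + c, h x hxP, by rwa [hl x hxP]⟩⟩
  invFun B := ⟨{x ∈ P | L x + c ∈ B.1}, B.2.1.affine_preimage L c h, by
    obtain ⟨y, hy⟩ := B.2.2
    have hyQ := B.2.1.subset hy
    exact ⟨L' y + c', h' y hyQ, by rwa [hr y hyQ]⟩⟩
  left_inv A := by
    apply Subtype.ext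
    ext x
    constructor
    · rintro ⟨hx, -, hx'⟩
      rwa [hl x hx] at hx'
    · intro hx
      have hxP := A.2.1.subset hx
      refine ⟨hxP, h x hxP, ?_⟩
      rwa [hl x hxP]
  right_inv B := by
    apply Subtype.ext
    ext y
    constructor
    · rintro ⟨hy, -, hy'⟩
      rwa [hr y hy] at hy'
    · intro hy
      have hyQ := B.2.1.subset hy
      refine ⟨hyQ, h' y hyQ, ?_⟩
      rwa [hr y hyQ]
  map_rel_iff' := by
    intro A B
    constructor
    · intro hAB x hx
      have hxP := A.2.1.subset hx
      have := @hAB (L x + c) ⟨h x hxP, by rwa [hl x hxP]⟩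
      have h2 := this.2
      rwa [hl x hxP] at h2
    · intro hAB y hy
      exact ⟨hy.1, hAB hy.2⟩

/-- If a face `Q` of `P` is an affine retract of `P`, its nonempty faces are the faces of `P`
below it. -/
noncomputable def NonemptyFace.retractOrderIso [ContinuousAdd E] {P : Set E} (Q : NonemptyFace P)
    (L : E →L[ℝ] E) (c : E) (h : ∀ x ∈ P, L x + c ∈ Q.1) (hid : ∀ x ∈ Q.1, L x + c = x) :
    NonemptyFace Q.1 ≃o Set.Iic Q :=
  OrderIso.ofSurjective (OrderEmbedding.ofMapLEIff
    (fun A => ⟨⟨A.1, by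
      have h1 : A.1 = {x ∈ P | L x + c ∈ A.1} ∩ Q.1 := by
        ext x
        constructor
        · intro hx
          have hxQ := A.2.1.subset hx
          exact ⟨⟨Q.2.1.subset hxQ, by rwa [hid x hxQ]⟩, hxQ⟩
        · rintro ⟨⟨-, hx⟩, hxQ⟩
          rwa [hid x hxQ] at hx
      rw [h1]
      exact (A.2.1.affine_preimage L c h).inter Q.2.1, A.2.2⟩, A.2.1.subset⟩)
    (fun A B => Iff.rfl)) (by
    rintro ⟨A, hA⟩
    exact ⟨⟨A.1, A.2.1.mono Q.2.1.subset hA, A.2.2⟩, rfl⟩)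

/-- Containment of a face of a polytope in a convex set can be checked on the generators. -/
theorem IsExposed.subset_of_forall_mem {S A B : Set E} (hA : IsExposed ℝ (convexHull ℝ S) A)
    (hB : Convex ℝ B) (h : ∀ s ∈ S, s ∈ A → s ∈ B) : A ⊆ B := by
  have key : convexHull ℝ S ⊆ {x | x ∈ convexHull ℝ S ∧ (x ∈ A → x ∈ B)} := by
    refine convexHull_min (fun s hs => ⟨subset_convexHull ℝ S hs, h s hs⟩) ?_
    rw [convex_iff_openSegment_subset]
    rintro x ⟨hx, hxB⟩ y ⟨hy, hyB⟩ z hz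
    have hconv := convex_convexHull ℝ S
    refine ⟨hconv.openSegment_subset hx hy hz, fun hzA => ?_⟩
    have hxA := hA.isExtreme.left_mem_of_mem_openSegment hx hy hzA hz
    have hyA := hA.isExtreme.left_mem_of_mem_openSegment hy hx hzA
      (by rwa [openSegment_symm])
    exact hB.openSegment_subset (hxB hxA) (hyB hyA) hz
  exact fun x hx => (key (hA.subset hx)).2 hx

end Faces

section PermutationPolytope

variable {n : ℕ} {G : Subgroup (Equiv.Perm (Fin n))}

theorem permMat_mem_permPoly {g : Equiv.Perm (Fin n)} (hg : g ∈ G) : permMat g ∈ permPoly G :=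
  subset_convexHull ℝ _ ⟨g, hg, rfl⟩

theorem permPoly_subset {C : Set (Matrix (Fin n) (Fin n) ℝ)} (hC : Convex ℝ C)
    (h : ∀ g ∈ G, permMat g ∈ C) : permPoly G ⊆ C :=
  convexHull_min (by rintro _ ⟨g, hg, rfl⟩; exact h g hg) hC

theorem permPoly_face_subset {A B : Set (Matrix (Fin n) (Fin n) ℝ)}
    (hA : IsExposed ℝ (permPoly G) A) (hB : Convex ℝ B)
    (h : ∀ g ∈ G, permMat g ∈ A → permMat g ∈ B) : A ⊆ B :=
  hA.subset_of_forall_mem hB (by rintro _ ⟨g, hg, rfl⟩; exact h g hg)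

/-- The linear functional recording minus the mass a matrix places outside the graphs of
`x` and `y`. -/
noncomputable def graphFunctional (x y : Equiv.Perm (Fin n)) :
    StrongDual ℝ (Matrix (Fin n) (Fin n) ℝ) :=
  LinearMap.toContinuousLinearMap
    { toFun := fun M => ∑ j, ∑ i, if i = x j ∨ i = y j then 0 else -M i j
      map_add' := fun M N => by
        simp only [← Finset.sum_add_distrib]
        refine Finset.sum_congr rfl fun j _ => Finset.sum_congr rfl fun i _ => ?_
        split_ifs
        · simp
        · simp only [Matrix.add_apply]; ring
      map_smul' := fun r M => by
        simp only [Finset.smul_sum, RingHom.id_apply]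
        refine Finset.sum_congr rfl fun j _ => Finset.sum_congr rfl fun i _ => ?_
        split_ifs <;> simp }

theorem graphFunctional_apply (x y : Equiv.Perm (Fin n)) (M : Matrix (Fin n) (Fin n) ℝ) :
    graphFunctional x y M = ∑ j, ∑ i, if i = x j ∨ i = y j then 0 else -M i j := rfl

theorem graphFunctional_permMat (x y z : Equiv.Perm (Fin n)) :
    graphFunctional x y (permMat z) = ∑ j, if z j = x j ∨ z j = y j then (0 : ℝ) else -1 := by
  rw [graphFunctional_apply]
  refine Finset.sum_congr rfl fun j _ => ?_
  rw [Finset.sum_eq_single (z j)]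
  · simp [permMat]
  · intro i _ hi
    simp [permMat, hi.symm]
  · simp

theorem graphFunctional_permMat_nonpos (x y z : Equiv.Perm (Fin n)) :
    graphFunctional x y (permMat z) ≤ 0 := by
  rw [graphFunctional_permMat]
  exact Finset.sum_nonpos fun j _ => by split_ifs <;> norm_num

theorem graphFunctional_permMat_eq_zero_iff (x y z : Equiv.Perm (Fin n)) :
    graphFunctional x y (permMat z) = 0 ↔ ∀ j, z j = x j ∨ z j = y j := by
  rw [graphFunctional_permMat,
    Finset.sum_eq_zero_iff_of_nonpos fun j _ => by split_ifs <;> norm_num]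
  refine ⟨fun h j => ?_, fun h j _ => if_pos (h j)⟩
  by_contra hj
  simpa [hj] using h j (Finset.mem_univ j)

theorem graphFunctional_nonpos (x y : Equiv.Perm (Fin n)) {M : Matrix (Fin n) (Fin n) ℝ}
    (hM : M ∈ permPoly G) : graphFunctional x y M ≤ 0 :=
  permPoly_subset (C := {M | graphFunctional x y M ≤ 0})
    (convex_halfSpace_le (graphFunctional x y).isLinear 0)
    (fun g _ => graphFunctional_permMat_nonpos x y g) hM

/-- The face of the permutation polytope spanned by the permutations `z` with
`z j ∈ {x j, y j}` for all `j`. -/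
noncomputable def graphFace (G : Subgroup (Equiv.Perm (Fin n))) (x y : Equiv.Perm (Fin n)) :
    Set (Matrix (Fin n) (Fin n) ℝ) :=
  (graphFunctional x y).toExposed (permPoly G)

theorem permMat_mem_graphFace_iff {x y z : Equiv.Perm (Fin n)} (hx : x ∈ G) (hz : z ∈ G) :
    permMat z ∈ graphFace G x y ↔ ∀ j, z j = x j ∨ z j = y j := by
  rw [← graphFunctional_permMat_eq_zero_iff]
  have hx0 : graphFunctional x y (permMat x) = 0 :=
    (graphFunctional_permMat_eq_zero_iff x y x).2 fun j => Or.inl rfl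
  constructor
  · rintro ⟨-, h⟩
    refine le_antisymm (graphFunctional_permMat_nonpos x y z) ?_
    rw [← hx0]
    exact h _ (permMat_mem_permPoly hx)
  · intro h
    refine ⟨permMat_mem_permPoly hz, fun M hM => ?_⟩
    rw [h]
    exact graphFunctional_nonpos x y hM

theorem isExposed_graphFace (x y : Equiv.Perm (Fin n)) :
    IsExposed ℝ (permPoly G) (graphFace G x y) :=
  ContinuousLinearMap.toExposed.isExposed

theorem graphFace_self {x : Equiv.Perm (Fin n)} (hx : x ∈ G) :
    graphFace G x x = {permMat x} := by
  refine Set.Subset.antisymm ?_ ?_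
  · refine permPoly_face_subset (isExposed_graphFace x x) (convex_singleton _) fun g hg h => ?_
    rw [permMat_mem_graphFace_iff hx hg] at h
    have : g = x := Equiv.ext fun j => by simpa using h j
    rw [this, Set.mem_singleton_iff]
  · rw [Set.singleton_subset_iff, permMat_mem_graphFace_iff hx hx]
    simp

/-- The vertex of the permutation polytope given by a group element. -/
def permVertex (g : G) : NonemptyFace (permPoly G) :=
  ⟨{permMat (g : Equiv.Perm (Fin n))}, by
    rw [← graphFace_self g.2]; exact isExposed_graphFace _ _, Set.singleton_nonempty _⟩

theorem permVertex_le_iff {g : G} {A : NonemptyFace (permPoly G)} :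
    permVertex g ≤ A ↔ permMat (g : Equiv.Perm (Fin n)) ∈ A.1 :=
  Set.singleton_subset_iff

theorem permMat_injective : Function.Injective (permMat (n := n)) := by
  intro g h hgh
  ext j
  have := congrFun (congrFun hgh (h j)) j
  simp only [permMat, Matrix.of_apply, if_true] at this
  by_contra hne
  rw [if_neg fun h' => hne (congrArg _ h')] at this
  exact zero_ne_one this

theorem eq_of_permVertex_le {g h : G} (hgh : permVertex g ≤ permVertex h) : g = h :=
  Subtype.ext (permMat_injective (permVertex_le_iff.1 hgh))

theorem exists_permVertex_le (A : NonemptyFace (permPoly G)) : ∃ g : G, permVertex g ≤ A := by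
  by_contra! h
  have : A.1 ⊆ ∅ := permPoly_face_subset A.2.1 convex_empty fun g hg hgA =>
    absurd (permVertex_le_iff.2 hgA) (h ⟨g, hg⟩)
  exact A.2.2.not_subset_empty this

/-- A vertex in every face through `x` and `y` agrees at each point with `x` or `y`. -/
theorem apply_eq_or_of_forall_face {x y z : G}
    (h : ∀ A, permVertex x ≤ A → permVertex y ≤ A → permVertex z ≤ A) (j : Fin n) :
    z.1 j = x.1 j ∨ z.1 j = y.1 j := by
  have hx : permMat x.1 ∈ graphFace G x.1 y.1 :=
    (permMat_mem_graphFace_iff x.2 x.2).2 fun j => Or.inl rfl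
  have hy : permMat y.1 ∈ graphFace G x.1 y.1 :=
    (permMat_mem_graphFace_iff x.2 y.2).2 fun j => Or.inr rfl
  exact (permMat_mem_graphFace_iff x.2 z.2).1 (permVertex_le_iff.1
    (h ⟨_, isExposed_graphFace x.1 y.1, _, hx⟩ (permVertex_le_iff.2 hx)
      (permVertex_le_iff.2 hy))) j

/-- Vertices `y`, `y'` spanning the same faces together with `x` are equal. -/
theorem eq_of_forall_face_iff {x y y' : G}
    (h : ∀ A, permVertex x ≤ A → (permVertex y ≤ A ↔ permVertex y' ≤ A)) : y = y' := by
  apply Subtype.ext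
  ext j : 1
  have h1 := apply_eq_or_of_forall_face (z := y') (fun A hx hy => (h A hx).1 hy) j
  have h2 := apply_eq_or_of_forall_face (z := y) (fun A hx hy => (h A hx).2 hy) j
  rcases h1 with h1 | h1
  · rcases h2 with h2 | h2 <;> simp_all
  · exact h1.symm

theorem permMat_apply_congr {σ τ : Equiv.Perm (Fin n)} {j : Fin n} (h : σ j = τ j) (i : Fin n) :
    permMat σ i j = permMat τ i j := by
  simp [permMat, h]

theorem mul_inv_apply_of_apply_eq {g z : Equiv.Perm (Fin n)} (h : ∀ j, z j = j ∨ z j = g j)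
    (j : Fin n) : (z j = j ∧ (g * z⁻¹) j = g j) ∨ (z j = g j ∧ (g * z⁻¹) j = j) := by
  obtain ⟨k, rfl⟩ := z.surjective j
  have hk' : (g * z⁻¹) (z k) = g k := by simp
  rw [hk']
  rcases h k with hk | hk
  · exact Or.inl ⟨congrArg z hk, by rw [hk]⟩
  · rcases h (z k) with hj | hj
    · exact Or.inl ⟨hj, by rw [z.injective hj]⟩
    · exact Or.inr ⟨hj, hk.symm⟩

theorem permMat_add_permMat_mul_inv {g z : Equiv.Perm (Fin n)}
    (h : ∀ j, z j = j ∨ z j = g j) :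
    permMat z + permMat (g * z⁻¹) = permMat 1 + permMat g := by
  ext i j
  simp only [Matrix.add_apply]
  rcases mul_inv_apply_of_apply_eq h j with ⟨h1, h2⟩ | ⟨h1, h2⟩
  · rw [permMat_apply_congr (τ := 1) h1, permMat_apply_congr h2]
  · rw [permMat_apply_congr h1, permMat_apply_congr (τ := 1) h2, add_comm]

theorem face_mem_and_mem_iff_of_add_eq {E : Type*} [AddCommGroup E] [Module ℝ E]
    [TopologicalSpace E] {P A : Set E} (hA : IsExposed ℝ P A) {x y z w : E} (hx : x ∈ P)
    (hy : y ∈ P) (hz : z ∈ P) (hw : w ∈ P) (h : x + y = z + w) (hxy : x ∈ A ∧ y ∈ A) :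
    z ∈ A ∧ w ∈ A := by
  obtain ⟨l, rfl⟩ := hA ⟨x, hxy.1⟩
  have hl : l x + l y = l z + l w := by rw [← map_add, h, map_add]
  have h1 := hxy.1.2 z hz
  have h2 := hxy.1.2 w hw
  have h3 := hxy.1.2 y hy
  have h4 := hxy.2.2 x hx
  have h5 := hxy.2.2 z hz
  have h6 := hxy.2.2 w hw
  exact ⟨⟨hz, fun v hv => by linarith [hxy.1.2 v hv]⟩,
    ⟨hw, fun v hv => by linarith [hxy.1.2 v hv]⟩⟩

/-- If `z` is a subproduct of `g`, then `z` and `g * z⁻¹` span the same faces as `1` and `g`. -/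
theorem permVertex_le_and_iff {g z : G} (h : ∀ j, z.1 j = j ∨ z.1 j = g.1 j)
    (A : NonemptyFace (permPoly G)) :
    (permVertex z ≤ A ∧ permVertex (g * z⁻¹) ≤ A) ↔ (permVertex 1 ≤ A ∧ permVertex g ≤ A) := by
  have key := permMat_add_permMat_mul_inv h
  have hm := fun g : G => permMat_mem_permPoly g.2
  simp only [permVertex_le_iff]
  exact ⟨face_mem_and_mem_iff_of_add_eq A.2.1 (hm z) (hm (g * z⁻¹)) (hm 1) (hm g) key,
    face_mem_and_mem_iff_of_add_eq A.2.1 (hm 1) (hm g) (hm z) (hm (g * z⁻¹)) key.symm⟩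

section Product

variable {X Y : Type*} [PartialOrder X] [PartialOrder Y] (φ : NonemptyFace (permPoly G) ≃o X × Y)

theorem permVertex_le_symm_iff {g : G} {p : X × Y} :
    permVertex g ≤ φ.symm p ↔ φ (permVertex g) ≤ p :=
  φ.le_symm_apply

theorem eq_of_le_permVertex {g : G} {p : X × Y} (h : p ≤ φ (permVertex g)) :
    p = φ (permVertex g) := by
  obtain ⟨m, hm⟩ := exists_permVertex_le (φ.symm p)
  have : m = g := eq_of_permVertex_le (hm.trans (φ.symm_apply_le.2 h))
  subst this
  exact le_antisymm h ((permVertex_le_symm_iff φ).1 hm)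

theorem fst_eq_of_le {g : G} {x : X} (h : x ≤ (φ (permVertex g)).1) :
    x = (φ (permVertex g)).1 :=
  congrArg Prod.fst (eq_of_le_permVertex φ (p := (x, (φ (permVertex g)).2)) ⟨h, le_rfl⟩)

theorem snd_eq_of_le {g : G} {y : Y} (h : y ≤ (φ (permVertex g)).2) :
    y = (φ (permVertex g)).2 :=
  congrArg Prod.snd (eq_of_le_permVertex φ (p := ((φ (permVertex g)).1, y)) ⟨le_rfl, h⟩)

theorem exists_permVertex_eq (a b : G) :
    ∃ k : G, φ (permVertex k) = ((φ (permVertex a)).1, (φ (permVertex b)).2) := by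
  obtain ⟨k, hk⟩ := exists_permVertex_le (φ.symm ((φ (permVertex a)).1, (φ (permVertex b)).2))
  rw [permVertex_le_symm_iff] at hk
  exact ⟨k, Prod.ext (fst_eq_of_le φ hk.1) (snd_eq_of_le φ hk.2)⟩

theorem eq_of_apply_permVertex_eq {a b : G} (h : φ (permVertex a) = φ (permVertex b)) : a = b :=
  eq_of_permVertex_le (φ.injective h).le

/-- The two components of a group element with respect to a product decomposition of the face
poset have disjoint supports and multiply to it. -/
theorem disjoint_and_eq_mul {x : X} {y : Y} (hx : ∀ x', x' ≤ x) (hy : ∀ y', y' ≤ y)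
    {g g₁ g₂ : G}
    (h₁ : φ (permVertex g₁) = ((φ (permVertex g)).1, (φ (permVertex 1)).2))
    (h₂ : φ (permVertex g₂) = ((φ (permVertex 1)).1, (φ (permVertex g)).2)) :
    g₁.1.Disjoint g₂.1 ∧ g = g₂ * g₁ := by
  have hsub : ∀ j, g₁.1 j = j ∨ g₁.1 j = g.1 j := by
    refine apply_eq_or_of_forall_face (x := 1) (y := g) fun A h1 hg => ?_
    rw [← φ.le_iff_le] at h1 hg ⊢
    rw [h₁]
    exact ⟨hg.1, h1.2⟩
  set a : G := g * g₁⁻¹ with ha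
  have hspan : ∀ p, (φ (permVertex g₁) ≤ p ∧ φ (permVertex a) ≤ p) ↔
      (φ (permVertex 1) ≤ p ∧ φ (permVertex g) ≤ p) := fun p => by
    simpa only [permVertex_le_symm_iff] using permVertex_le_and_iff hsub (φ.symm p)
  have hfst : (φ (permVertex a)).1 = (φ (permVertex 1)).1 := by
    obtain ⟨k, hk⟩ := exists_permVertex_eq φ a 1
    have : k = 1 := by
      refine eq_of_forall_face_iff (x := g₁) fun A hA => ?_
      rw [← φ.le_iff_le] at hA
      rw [← φ.le_iff_le, ← φ.le_iff_le, hk]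
      have hp := hspan ((φ A).1, y)
      rw [h₁] at hp hA
      constructor
      · intro h
        exact ⟨((hp.1 ⟨⟨hA.1, hy _⟩, ⟨h.1, hy _⟩⟩).1).1, h.2⟩
      · intro h
        exact ⟨((hp.2 ⟨⟨h.1, hy _⟩, ⟨hA.1, hy _⟩⟩).2).1, h.2⟩
    rw [← congrArg Prod.fst hk, this]
  have hsnd : (φ (permVertex a)).2 = (φ (permVertex g)).2 := by
    obtain ⟨k, hk⟩ := exists_permVertex_eq φ 1 a
    have : k = g₂ := by
      refine eq_of_forall_face_iff (x := 1) fun A hA => ?_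
      rw [← φ.le_iff_le] at hA
      rw [← φ.le_iff_le, ← φ.le_iff_le, hk, h₂]
      have hp := hspan (x, (φ A).2)
      rw [h₁] at hp
      constructor
      · intro h
        exact ⟨h.1, ((hp.1 ⟨⟨hx _, hA.2⟩, ⟨hx _, h.2⟩⟩).2).2⟩
      · intro h
        exact ⟨h.1, ((hp.2 ⟨⟨hx _, hA.2⟩, ⟨hx _, h.2⟩⟩).2).2⟩
    rw [← congrArg Prod.snd hk, this, h₂]
  have hag : a = g₂ := eq_of_apply_permVertex_eq φ (by rw [h₂]; exact Prod.ext hfst hsnd)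
  refine ⟨fun j => ?_, by rw [← hag, ha]; group⟩
  rw [← hag]
  rcases mul_inv_apply_of_apply_eq hsub j with h | h
  · exact Or.inl h.1
  · exact Or.inr h.2

end Product

section DirectProduct

variable {H₁ H₂ : Subgroup (Equiv.Perm (Fin n))}

open Classical in
/-- The linear part of the affine map replacing the columns outside `T` by those of the identity
matrix. -/
noncomputable def columnProj (T : Set (Fin n)) :
    Matrix (Fin n) (Fin n) ℝ →L[ℝ] Matrix (Fin n) (Fin n) ℝ :=
  LinearMap.toContinuousLinearMap
    { toFun := fun M => Matrix.of fun i j => if j ∈ T then M i j else 0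
      map_add' := fun M N => by
        ext i j
        simp only [Matrix.add_apply, Matrix.of_apply]
        split_ifs <;> simp
      map_smul' := fun r M => by
        ext i j
        simp }

theorem columnProj_apply_of_mem {T : Set (Fin n)} {M : Matrix (Fin n) (Fin n) ℝ} {j : Fin n}
    (hj : j ∈ T) (i : Fin n) : columnProj T M i j = M i j :=
  if_pos hj

theorem columnProj_apply_of_notMem {T : Set (Fin n)} {M : Matrix (Fin n) (Fin n) ℝ} {j : Fin n}
    (hj : j ∉ T) (i : Fin n) : columnProj T M i j = 0 :=
  if_neg hj

theorem columnProj_add_compl (T : Set (Fin n)) (M : Matrix (Fin n) (Fin n) ℝ) :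
    columnProj T M + columnProj Tᶜ M = M := by
  ext i j
  rw [Matrix.add_apply]
  by_cases hj : j ∈ T
  · rw [columnProj_apply_of_mem hj, columnProj_apply_of_notMem (T := Tᶜ) (by simpa using hj),
      add_zero]
  · rw [columnProj_apply_of_notMem hj, columnProj_apply_of_mem (T := Tᶜ) hj, zero_add]

/-- The columns of `permPoly H` at common fixed points of `H` are those of the identity. -/
theorem columnProj_eq_of_mem_permPoly {H : Subgroup (Equiv.Perm (Fin n))} {T : Set (Fin n)}
    (hT : ∀ h ∈ H, ∀ j ∈ T, h j = j) {M : Matrix (Fin n) (Fin n) ℝ} (hM : M ∈ permPoly H) :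
    columnProj T M = columnProj T (permMat 1) := by
  refine permPoly_subset (C := {M | columnProj T M = columnProj T (permMat 1)}) ?_ ?_ hM
  · exact (convex_singleton (𝕜 := ℝ) (columnProj T (permMat 1))).linear_preimage
      (columnProj T).toLinearMap
  · intro g hg
    ext i j
    by_cases hj : j ∈ T
    · rw [columnProj_apply_of_mem hj, columnProj_apply_of_mem hj]
      exact permMat_apply_congr (hT g hg j hj) i
    · rw [columnProj_apply_of_notMem hj, columnProj_apply_of_notMem hj]

/-- The affine map `columnProj T + const` fixes `permPoly H` if `H` fixes the complement of `T`. -/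
theorem columnProj_add_eq_self {H : Subgroup (Equiv.Perm (Fin n))} {T : Set (Fin n)}
    (hT : ∀ h ∈ H, ∀ j ∈ Tᶜ, h j = j) {M : Matrix (Fin n) (Fin n) ℝ} (hM : M ∈ permPoly H) :
    columnProj T M + columnProj Tᶜ (permMat 1) = M := by
  rw [← columnProj_eq_of_mem_permPoly hT hM, columnProj_add_compl]

/-- If `G = H₁ H₂` where `H₁` fixes the complement of `T` and `H₂` fixes `T`, then
`columnProj T + const` maps `permPoly G` to `permPoly H₁`. -/
theorem columnProj_add_mem {T : Set (Fin n)} (h₁T : ∀ h ∈ H₁, ∀ j ∈ Tᶜ, h j = j)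
    (h₂T : ∀ h ∈ H₂, ∀ j ∈ T, h j = j) (hG : ∀ g ∈ G, ∃ h₁ ∈ H₁, ∃ h₂ ∈ H₂, g = h₁ * h₂)
    {M : Matrix (Fin n) (Fin n) ℝ} (hM : M ∈ permPoly G) :
    columnProj T M + columnProj Tᶜ (permMat 1) ∈ permPoly H₁ := by
  refine permPoly_subset (C := {M | columnProj T M + columnProj Tᶜ (permMat 1) ∈ permPoly H₁})
    ?_ ?_ hM
  · exact ((convex_convexHull ℝ _).translate_preimage_left _).linear_preimage
      (columnProj T).toLinearMap
  · intro g hg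
    obtain ⟨a, ha, b, hb, rfl⟩ := hG g hg
    have : columnProj T (permMat (a * b)) + columnProj Tᶜ (permMat 1) = permMat a := by
      rw [← columnProj_add_eq_self h₁T (permMat_mem_permPoly ha)]
      congr 1
      ext i j
      by_cases hj : j ∈ T
      · rw [columnProj_apply_of_mem hj, columnProj_apply_of_mem hj]
        exact permMat_apply_congr (σ := a * b) (congrArg a (h₂T b hb j hj)) i
      · rw [columnProj_apply_of_notMem hj, columnProj_apply_of_notMem hj]
    rw [Set.mem_ofPred_eq, this]
    exact permMat_mem_permPoly ha

theorem permMat_mul_add_one {a b : Equiv.Perm (Fin n)} (h : a.Disjoint b) :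
    permMat (a * b) + permMat 1 = permMat a + permMat b := by
  ext i j
  simp only [Matrix.add_apply]
  rcases h j with hj | hj
  · rw [h.commute.eq, permMat_apply_congr (σ := b * a) (τ := b) (congrArg b hj),
      permMat_apply_congr (σ := a) (τ := 1) hj, add_comm]
  · rw [permMat_apply_congr (σ := a * b) (τ := a) (congrArg a hj),
      permMat_apply_congr (σ := b) (τ := 1) hj]

/-- The set of points moved by a permutation group. -/
def movedPoints (H : Subgroup (Equiv.Perm (Fin n))) : Set (Fin n) := {x | ∃ h ∈ H, h x ≠ x}

theorem apply_eq_of_mem_compl_movedPoints {H : Subgroup (Equiv.Perm (Fin n))} :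
    ∀ h ∈ H, ∀ j ∈ (movedPoints H)ᶜ, h j = j := by
  intro h hh j hj
  by_contra hne
  exact hj ⟨h, hh, hne⟩

theorem apply_eq_of_mem_movedPoints (hd : ∀ a ∈ H₁, ∀ b ∈ H₂, a.Disjoint b) :
    ∀ h ∈ H₂, ∀ j ∈ movedPoints H₁, h j = j := by
  rintro h hh j ⟨a, ha, hne⟩
  exact (hd a ha h hh j).resolve_left hne

theorem sub_mem_permPoly (h₁ : H₁ ≤ G) (h₂ : H₂ ≤ G)
    (hd : ∀ a ∈ H₁, ∀ b ∈ H₂, a.Disjoint b) {A B : Matrix (Fin n) (Fin n) ℝ}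
    (hA : A ∈ permPoly H₁) (hB : B ∈ permPoly H₂) : A + B - permMat 1 ∈ permPoly G := by
  have hconv : Convex ℝ (permPoly G) := convex_convexHull ℝ _
  refine permPoly_subset (G := H₁) (C := {A | A + B - permMat 1 ∈ permPoly G}) ?_ ?_ hA
  · simp only [add_sub_assoc]
    exact hconv.translate_preimage_left (B - permMat 1)
  · intro a ha
    refine permPoly_subset (G := H₂) (C := {B | permMat a + B - permMat 1 ∈ permPoly G}) ?_ ?_ hB
    · simp only [add_sub_right_comm]
      exact hconv.translate_preimage_right (permMat a - permMat 1)
    · intro b hb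
      rw [Set.mem_ofPred_eq, ← permMat_mul_add_one (hd a ha b hb), add_sub_cancel_right]
      exact permMat_mem_permPoly (G.mul_mem (h₁ ha) (h₂ hb))

/-- The permutation polytope of an internal direct product with disjoint supports is affinely
the product of the permutation polytopes of the factors. -/
noncomputable def permPolyProdOrderIso (h₁ : H₁ ≤ G) (h₂ : H₂ ≤ G)
    (hd : ∀ a ∈ H₁, ∀ b ∈ H₂, a.Disjoint b)
    (hG : ∀ g ∈ G, ∃ h₁ ∈ H₁, ∃ h₂ ∈ H₂, g = h₁ * h₂) :
    NonemptyFace (permPoly G) ≃o NonemptyFace (permPoly H₁ ×ˢ permPoly H₂) :=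
  have hG' : ∀ g ∈ G, ∃ h₂ ∈ H₂, ∃ h₁ ∈ H₁, g = h₂ * h₁ := fun g hg => by
    obtain ⟨a, ha, b, hb, rfl⟩ := hG g hg
    exact ⟨b, hb, a, ha, (hd a ha b hb).commute.eq⟩
  have h11 := apply_eq_of_mem_compl_movedPoints (H := H₁)
  have h21 := apply_eq_of_mem_movedPoints hd
  have h21' : ∀ h ∈ H₂, ∀ j ∈ (movedPoints H₁)ᶜᶜ, h j = j := by rwa [compl_compl]
  NonemptyFace.affineOrderIso
    ((columnProj (movedPoints H₁)).prod (columnProj (movedPoints H₁)ᶜ))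
    (columnProj (movedPoints H₁)ᶜ (permMat 1), columnProj (movedPoints H₁)ᶜᶜ (permMat 1))
    (ContinuousLinearMap.fst ℝ _ _ + ContinuousLinearMap.snd ℝ _ _) (-permMat 1)
    (fun M hM => ⟨columnProj_add_mem h11 h21 hG hM, columnProj_add_mem h21' h11 hG' hM⟩)
    (fun p hp => by
      simpa [sub_eq_add_neg] using sub_mem_permPoly h₁ h₂ hd hp.1 hp.2)
    (fun M _ => by
      have e1 := columnProj_add_compl (movedPoints H₁) M
      have e2 := columnProj_add_compl (movedPoints H₁)ᶜ (permMat 1)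
      simp only [ContinuousLinearMap.prod_apply, Prod.mk_add_mk, add_apply,
        ContinuousLinearMap.coe_fst', ContinuousLinearMap.coe_snd']
      rw [add_add_add_comm, e1, e2, add_neg_cancel_right])
    (fun p hp => by
      have e1 := columnProj_add_eq_self h11 hp.1
      have e2 := columnProj_add_eq_self h21' hp.2
      have e3 := columnProj_eq_of_mem_permPoly h11 hp.1
      have e4 := columnProj_eq_of_mem_permPoly h21 hp.2
      refine Prod.ext ?_ ?_
      · simp [e4, e1]
      · simp [e3]
        simpa using e2)

end DirectProduct

section ComponentSubgroup

variable {X Y : Type*} [PartialOrder X] [PartialOrder Y] (φ : NonemptyFace (permPoly G) ≃o X × Y)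

/-- For a product decomposition of the face poset of `permPoly G`, the elements of `G` disjoint
from every element lying over the first component of the identity. -/
def componentSubgroup : Subgroup (Equiv.Perm (Fin n)) where
  carrier := {z | z ∈ G ∧ ∀ b : G, (φ (permVertex b)).1 = (φ (permVertex 1)).1 → z.Disjoint b.1}
  mul_mem' hx hy := ⟨G.mul_mem hx.1 hy.1, fun b hb => (hx.2 b hb).mul_left (hy.2 b hb)⟩
  one_mem' := ⟨G.one_mem, fun b _ => Equiv.Perm.disjoint_one_left b.1⟩
  inv_mem' hx := ⟨G.inv_mem hx.1, fun b hb => (hx.2 b hb).inv_left⟩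

theorem componentSubgroup_le : componentSubgroup φ ≤ G := fun _ h => h.1

variable {φ} {x : X} {y : Y}

theorem disjoint_of_components (hx : ∀ x', x' ≤ x) (hy : ∀ y', y' ≤ y) {a b : G}
    (ha : (φ (permVertex a)).2 = (φ (permVertex 1)).2)
    (hb : (φ (permVertex b)).1 = (φ (permVertex 1)).1) : a.1.Disjoint b.1 := by
  obtain ⟨g, hg⟩ := exists_permVertex_eq φ a b
  refine (disjoint_and_eq_mul φ hx hy (g := g) ?_ ?_).1
  · rw [hg]
    exact Prod.ext rfl ha
  · rw [hg]
    exact Prod.ext hb rfl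

theorem exists_eq_mul_components (hx : ∀ x', x' ≤ x) (hy : ∀ y', y' ≤ y) (g : G) : ∃ a b : G,
    (φ (permVertex a)).2 = (φ (permVertex 1)).2 ∧ (φ (permVertex b)).1 = (φ (permVertex 1)).1 ∧
      g = a * b := by
  obtain ⟨a, ha⟩ := exists_permVertex_eq φ g 1
  obtain ⟨b, hb⟩ := exists_permVertex_eq φ 1 g
  obtain ⟨hd, hab⟩ := disjoint_and_eq_mul φ hx hy ha hb
  refine ⟨a, b, by rw [ha], by rw [hb], ?_⟩
  rw [hab]
  exact Subtype.ext hd.symm.commute.eq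

theorem mem_componentSubgroup_iff (hx : ∀ x', x' ≤ x) (hy : ∀ y', y' ≤ y) {g : G} :
    g.1 ∈ componentSubgroup φ ↔ (φ (permVertex g)).2 = (φ (permVertex 1)).2 := by
  refine ⟨fun hg => ?_, fun hg => ⟨g.2, fun b hb => disjoint_of_components hx hy hg hb⟩⟩
  obtain ⟨a, b, ha, hb, rfl⟩ := exists_eq_mul_components hx hy g
  have hbb : b.1.Disjoint b.1 := by
    have := ((disjoint_of_components hx hy ha hb).inv_left).mul_left (hg.2 b hb)
    simpa using this
  have hb1 : b = 1 := Subtype.ext (Equiv.Perm.disjoint_refl_iff.1 hbb)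
  rw [hb1, mul_one, ha]

theorem componentSubgroup_disjoint (hx : ∀ x', x' ≤ x) (hy : ∀ y', y' ≤ y) :
    ∀ a ∈ componentSubgroup φ, ∀ b ∈ componentSubgroup (φ.trans OrderIso.prodComm),
      a.Disjoint b := fun _ ha b hb =>
  ha.2 ⟨b, hb.1⟩ ((mem_componentSubgroup_iff (φ := φ.trans OrderIso.prodComm) hy hx).1 hb)

theorem exists_eq_mul_componentSubgroup (hx : ∀ x', x' ≤ x) (hy : ∀ y', y' ≤ y) :
    ∀ g ∈ G, ∃ a ∈ componentSubgroup φ, ∃ b ∈ componentSubgroup (φ.trans OrderIso.prodComm),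
      g = a * b := by
  intro g hg
  obtain ⟨a, b, ha, hb, h⟩ := exists_eq_mul_components hx hy ⟨g, hg⟩
  exact ⟨a, (mem_componentSubgroup_iff hx hy).2 ha, b,
    (mem_componentSubgroup_iff (φ := φ.trans OrderIso.prodComm) hy hx).2 hb,
    congrArg Subtype.val h⟩

theorem face_eq_permPoly_componentSubgroup (hx : ∀ x', x' ≤ x) (hy : ∀ y', y' ≤ y) :
    (φ.symm (x, (φ (permVertex 1)).2)).1 = permPoly (componentSubgroup φ) := by
  have hmem : ∀ g : G, permMat g.1 ∈ (φ.symm (x, (φ (permVertex 1)).2)).1 ↔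
      g.1 ∈ componentSubgroup φ := by
    intro g
    rw [← permVertex_le_iff, permVertex_le_symm_iff, mem_componentSubgroup_iff hx hy]
    exact ⟨fun h => (snd_eq_of_le φ h.2), fun h => ⟨hx _, h.le⟩⟩
  refine Set.Subset.antisymm ?_ ?_
  · exact permPoly_face_subset (φ.symm _).2.1 (convex_convexHull ℝ _) fun g hg h =>
      permMat_mem_permPoly ((hmem ⟨g, hg⟩).1 h)
  · exact permPoly_subset ((φ.symm _).2.1.convex (convex_convexHull ℝ _)) fun g hg =>
      (hmem ⟨g, hg.1⟩).2 hg

theorem nonempty_componentSubgroup_orderIso (hx : ∀ x', x' ≤ x) (hy : ∀ y', y' ≤ y) :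
    Nonempty (NonemptyFace (permPoly (componentSubgroup φ)) ≃o X) := by
  have hd := componentSubgroup_disjoint (φ := φ) hx hy
  have h11 := apply_eq_of_mem_compl_movedPoints (H := componentSubgroup φ)
  have hface := face_eq_permPoly_componentSubgroup (φ := φ) hx hy
  have e := NonemptyFace.retractOrderIso (φ.symm (x, (φ (permVertex 1)).2))
    (columnProj (movedPoints (componentSubgroup φ)))
    (columnProj (movedPoints (componentSubgroup φ))ᶜ (permMat 1))
    (fun M hM => by
      rw [hface]
      exact columnProj_add_mem h11 (apply_eq_of_mem_movedPoints hd)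
        (exists_eq_mul_componentSubgroup hx hy) hM)
    (fun M hM => by
      rw [hface] at hM
      exact columnProj_add_eq_self h11 hM)
  rw [hface] at e
  have hsnd : ∀ A : Set.Iic (φ.symm (x, (φ (permVertex 1)).2)),
      (φ A.1).2 = (φ (permVertex 1)).2 := fun A =>
    snd_eq_of_le φ (φ.le_symm_apply.1 A.2).2
  refine ⟨e.trans (OrderIso.ofSurjective (OrderEmbedding.ofMapLEIff (fun A => (φ A.1).1) ?_) ?_)⟩
  · intro A B
    rw [← Subtype.coe_le_coe, ← φ.le_iff_le, Prod.le_def, hsnd, hsnd]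
    simp
  · intro x'
    exact ⟨⟨φ.symm (x', (φ (permVertex 1)).2), φ.symm.monotone ⟨hx x', le_rfl⟩⟩, by simp⟩

end ComponentSubgroup

end PermutationPolytope

/-- `P(G)` is combinatorially a product `Δ₁ × Δ₂` iff `G` is the
internal direct product of two subgroups `H₁`, `H₂` with disjoint supports whose
permutation polytopes are combinatorially `Δ₁` and `Δ₂`. -/
theorem stmt_13 (n a b : ℕ) (G : Subgroup (Equiv.Perm (Fin n)))
    (S₁ : Finset (Fin a → ℝ)) (S₂ : Finset (Fin b → ℝ))
    (Δ₁ : Set (Fin a → ℝ)) (Δ₂ : Set (Fin b → ℝ))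
    (hΔ₁ : Δ₁ = convexHull ℝ (S₁ : Set (Fin a → ℝ)))
    (hΔ₂ : Δ₂ = convexHull ℝ (S₂ : Set (Fin b → ℝ))) :
    CombEquiv (permPoly G) (Δ₁ ×ˢ Δ₂) ↔
      ∃ H₁ H₂ : Subgroup (Equiv.Perm (Fin n)),
        H₁ ≤ G ∧ H₂ ≤ G ∧
        CombEquiv (permPoly H₁) Δ₁ ∧ CombEquiv (permPoly H₂) Δ₂ ∧
        (∀ x : Fin n, ¬ ((∃ h ∈ H₁, h x ≠ x) ∧ (∃ h ∈ H₂, h x ≠ x))) ∧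
        (∀ g ∈ G, ∃ h₁ ∈ H₁, ∃ h₂ ∈ H₂, g = h₁ * h₂) ∧
        H₁ ⊓ H₂ = ⊥ ∧
        (∀ h₁ ∈ H₁, ∀ h₂ ∈ H₂, Commute h₁ h₂) := by
  constructor
  · intro h
    obtain ⟨e⟩ := h.nonempty_face_orderIso
    obtain ⟨hne₁, hne₂⟩ := Set.prod_nonempty_iff.1 ((e (permVertex 1)).2.2.mono
      (e (permVertex 1)).2.1.subset)
    let φ := e.trans (NonemptyFace.prodOrderIso Δ₁ Δ₂).symm
    have hx := NonemptyFace.le_whole hne₁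
    have hy := NonemptyFace.le_whole hne₂
    have hd := componentSubgroup_disjoint (φ := φ) hx hy
    obtain ⟨e₁⟩ := nonempty_componentSubgroup_orderIso (φ := φ) hx hy
    obtain ⟨e₂⟩ := nonempty_componentSubgroup_orderIso (φ := φ.trans OrderIso.prodComm) hy hx
    refine ⟨componentSubgroup φ, componentSubgroup (φ.trans OrderIso.prodComm),
      componentSubgroup_le _, componentSubgroup_le _, combEquiv_of_orderIso e₁,
      combEquiv_of_orderIso e₂, ?_, exists_eq_mul_componentSubgroup hx hy, ?_,
      fun a ha b hb => (hd a ha b hb).commute⟩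
    · rintro x ⟨⟨a, ha, hax⟩, b, hb, hbx⟩
      exact (hd a ha b hb x).elim hax hbx
    · rw [eq_bot_iff]
      exact fun g hg => Equiv.Perm.disjoint_refl_iff.1 (hd g hg.1 g hg.2)
  · rintro ⟨H₁, H₂, h₁, h₂, he₁, he₂, hsupp, hG, -, -⟩
    obtain ⟨e₁⟩ := he₁.nonempty_face_orderIso
    obtain ⟨e₂⟩ := he₂.nonempty_face_orderIso
    have hd : ∀ a ∈ H₁, ∀ b ∈ H₂, a.Disjoint b := fun a ha b hb x => by
      by_contra! hx
      exact hsupp x ⟨⟨a, ha, hx.1⟩, b, hb, hx.2⟩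
    exact combEquiv_of_orderIso ((permPolyProdOrderIso h₁ h₂ hd hG).trans
      ((NonemptyFace.prodOrderIso _ _).symm.trans
        ((NonemptyFace.prodCongr e₁ e₂).trans (NonemptyFace.prodOrderIso _ _))))
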